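/- arXiv:2206.04752 — 3 statements merged into one kernel-verified Lean document; each statement's English description precedes it below -/
import Mathlib

section
/- Let A = (a_i)_{i≥1} be a strictly increasing sequence of positive integers with gcd(a_1, a_2) = 1. Then for all integers a, b > 4·a_1·a_2, one has p_A(a,2)·p_A(b,2) > p_A(a+b,2). -/
/-- The restricted partition function `p_A(n,k)` for the sequence `a` (0-indexed, so the
paper's `a_i` is `a (i-1)`): the number of `k`-tuples `(c_0,…,c_{k-1})` of nonnegative
integers with `c_0·a_0 + ⋯ + c_{k-1}·a_{k-1} = n`.
It equals `0` for `n < 0` and `1` for `n = 0`. -/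
noncomputable def pA (a : ℕ → ℕ) (k : ℕ) (n : ℤ) : ℕ :=
  Set.ncard {c : Fin k → ℕ | (∑ i, (c i : ℤ) * (a i.val : ℤ)) = n}

/-- Solutions of `c 0 * p + c 1 * q = n` with `n < N * p * q` are determined by `c 1 / p < N`. -/
lemma div_mapsTo_and_injOn_solutions {p q : ℕ} (hp : 0 < p) (hq : 0 < q) (h : Nat.Coprime p q)
    {n : ℤ} {N : ℕ} (hn : n < N * p * q) :
    Set.MapsTo (fun c : Fin 2 → ℕ => c 1 / p)
        {c : Fin 2 → ℕ | (c 0 : ℤ) * p + (c 1 : ℤ) * q = n} (Finset.range N : Set ℕ) ∧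
      Set.InjOn (fun c : Fin 2 → ℕ => c 1 / p)
        {c : Fin 2 → ℕ | (c 0 : ℤ) * p + (c 1 : ℤ) * q = n} := by
  constructor
  · intro c hc
    simp only [Set.mem_ofPred_eq] at hc
    simp only [Finset.coe_range, Set.mem_Iio]
    rw [Nat.div_lt_iff_lt_mul hp]
    have h0 : (0 : ℤ) ≤ (c 0 : ℤ) * p := by positivity
    have h1 : (c 1 : ℤ) * q < (N * p : ℤ) * q := by linarith
    have h2 : (c 1 : ℤ) < N * p := lt_of_mul_lt_mul_right h1 (by positivity)
    exact_mod_cast h2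
  · intro c hc d hd hcd
    simp only [Set.mem_ofPred_eq] at hc hd
    simp only at hcd
    have hdvd : (p : ℤ) ∣ ((d 1 : ℤ) - c 1) * q := ⟨(c 0 : ℤ) - d 0, by linarith⟩
    have hdvd' : (p : ℤ) ∣ (d 1 : ℤ) - c 1 :=
      (Nat.isCoprime_iff_coprime.mpr h).dvd_of_dvd_mul_right hdvd
    have hmod : c 1 % p = d 1 % p := (Nat.modEq_iff_dvd).mpr hdvd'
    have e1 : c 1 = d 1 := by
      rw [← Nat.div_add_mod (c 1) p, ← Nat.div_add_mod (d 1) p, hcd, hmod]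
    have e0 : c 0 = d 0 := by
      rw [e1] at hc
      have : (c 0 : ℤ) * p = (d 0 : ℤ) * p := by linarith
      have := mul_right_cancel₀ (by exact_mod_cast hp.ne') this
      exact_mod_cast this
    ext i
    fin_cases i
    · exact e0
    · exact e1

lemma ncard_solutions_le {p q : ℕ} (hp : 0 < p) (hq : 0 < q) (h : Nat.Coprime p q)
    {n : ℤ} {N : ℕ} (hn : n < N * p * q) :
    Set.ncard {c : Fin 2 → ℕ | (c 0 : ℤ) * p + (c 1 : ℤ) * q = n} ≤ N := by
  obtain ⟨hm, hi⟩ := div_mapsTo_and_injOn_solutions hp hq h hn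
  simpa using Set.ncard_le_ncard_of_injOn _ hm hi (Finset.finite_toSet _)

lemma finite_solutions {p q : ℕ} (hp : 0 < p) (hq : 0 < q) (h : Nat.Coprime p q) (n : ℤ) :
    {c : Fin 2 → ℕ | (c 0 : ℤ) * p + (c 1 : ℤ) * q = n}.Finite := by
  have hn : n < ((n.toNat + 1 : ℕ) : ℤ) * p * q := by
    have h1 : (1 : ℤ) ≤ (p : ℤ) * q := by exact_mod_cast Nat.mul_pos hp hq
    have h2 : n ≤ (n.toNat : ℤ) := Int.self_le_toNat n
    push_cast
    nlinarith [Int.natCast_nonneg n.toNat]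
  obtain ⟨hm, hi⟩ := div_mapsTo_and_injOn_solutions hp hq h hn
  exact Set.Finite.of_injOn hm hi (Finset.finite_toSet _)

lemma le_ncard_solutions {p q : ℕ} (hp : 0 < p) (hq : 0 < q) (h : Nat.Coprime p q)
    {n : ℤ} {N : ℕ} (hn : (N : ℤ) * p * q ≤ n) :
    N ≤ Set.ncard {c : Fin 2 → ℕ | (c 0 : ℤ) * p + (c 1 : ℤ) * q = n} := by
  have hpz : (0 : ℤ) < p := by exact_mod_cast hp
  have hqz : (0 : ℤ) < q := by exact_mod_cast hq
  obtain ⟨x, y, hxy, hy0, hyp⟩ : ∃ x y : ℤ, x * p + y * q = n ∧ 0 ≤ y ∧ y < p := by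
    obtain ⟨u, v, huv⟩ := Nat.isCoprime_iff_coprime.mpr h
    refine ⟨n * u + (n * v / p) * q, (n * v) % p, ?_, Int.emod_nonneg _ hpz.ne',
      Int.emod_lt_of_pos _ hpz⟩
    have := Int.emod_add_mul_ediv (n * v) p
    linear_combination (q : ℤ) * this + n * huv
  have hx : ∀ t : ℕ, t < N → (0 : ℤ) ≤ x - t * q := by
    intro t ht
    have ht' : (t : ℤ) + 1 ≤ N := by exact_mod_cast ht
    have h1 : ((t : ℤ) + 1) * (p * q) ≤ N * (p * q) :=
      mul_le_mul_of_nonneg_right ht' (by positivity)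
    have h2 : y * q < p * q := mul_lt_mul_of_pos_right hyp hqz
    have h3 : 0 < (x - t * q) * p := by linarith
    exact (pos_of_mul_pos_left h3 hpz.le).le
  have key := Set.ncard_le_ncard_of_injOn (s := (Finset.range N : Set ℕ))
    (t := {c : Fin 2 → ℕ | (c 0 : ℤ) * p + (c 1 : ℤ) * q = n})
    (fun t => ![(x - t * q).toNat, (y + t * p).toNat]) ?_ ?_ (finite_solutions hp hq h n)
  · simpa using key
  · intro t ht
    have h1 := hx t (by simpa using ht)
    have h2 : (0 : ℤ) ≤ y + t * p := by positivity
    simp only [Set.mem_ofPred_eq, Matrix.cons_val_zero, Matrix.cons_val_one,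
      Int.toNat_of_nonneg h1, Int.toNat_of_nonneg h2]
    linarith
  · intro s _ t _ hst
    have h1 : (y + s * p).toNat = (y + t * p).toNat := by simpa using congrFun hst 1
    have h2 : (0 : ℤ) ≤ y + s * p := by positivity
    have h3 : (0 : ℤ) ≤ y + t * p := by positivity
    have h4 : (s : ℤ) * p = t * p := by
      have h5 := congrArg (Nat.cast : ℕ → ℤ) h1
      rw [Int.toNat_of_nonneg h2, Int.toNat_of_nonneg h3] at h5
      linarith
    exact_mod_cast mul_right_cancel₀ hpz.ne' h4

theorem stmt3 (a : ℕ → ℕ) (hpos : ∀ i, 0 < a i) (hmono : StrictMono a)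
    (hgcd : Nat.gcd (a 0) (a 1) = 1) :
    ∀ m n : ℤ, 4 * (a 0 : ℤ) * (a 1 : ℤ) < m → 4 * (a 0 : ℤ) * (a 1 : ℤ) < n →
      pA a 2 (m + n) < pA a 2 m * pA a 2 n := by
  intro m n hm hn
  simp only [pA, Fin.sum_univ_two, Fin.val_zero, Fin.val_one]
  have hP : (0 : ℤ) < (a 0 : ℤ) * a 1 := by exact_mod_cast Nat.mul_pos (hpos 0) (hpos 1)
  have quot : ∀ k : ℤ, 4 * (a 0 : ℤ) * a 1 < k → ∃ K : ℕ, 4 ≤ K ∧ (K : ℤ) * a 0 * a 1 ≤ k ∧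
      k < (K + 1) * a 0 * a 1 := by
    intro k hk
    have h4 : 4 ≤ k / ((a 0 : ℤ) * a 1) := by
      rw [Int.le_ediv_iff_mul_le hP]
      linarith
    obtain ⟨K, hK⟩ := Int.eq_ofNat_of_zero_le (by linarith : 0 ≤ k / ((a 0 : ℤ) * a 1))
    have h5 := Int.ediv_mul_le k hP.ne'
    have h6 := Int.lt_ediv_add_one_mul_self k hP
    rw [hK] at h4 h5 h6
    exact ⟨K, by exact_mod_cast h4, by linarith, by linarith⟩
  obtain ⟨M, hM4, hM, hM'⟩ := quot m hm
  obtain ⟨N, hN4, hN, hN'⟩ := quot n hn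
  have hmn : m + n < ((M + N + 2 : ℕ) : ℤ) * a 0 * a 1 := by
    push_cast
    linarith
  calc _ ≤ M + N + 2 := ncard_solutions_le (hpos 0) (hpos 1) hgcd hmn
    _ < M * N := by nlinarith
    _ ≤ _ := Nat.mul_le_mul (le_ncard_solutions (hpos 0) (hpos 1) hgcd hM)
      (le_ncard_solutions (hpos 0) (hpos 1) hgcd hN)
end

section
/- Let A = (a_i)_{i≥1} be a strictly increasing sequence of positive integers such that gcd(a_i, a_j) = 1 for all 1 ≤ i < j ≤ 4. Set σ = a_1+a_2+a_3+a_4, s_2 = a_1²+a_2²+a_3²+a_4², α = 1/(3!·a_1a_2a_3a_4), β = σ/(4·a_1a_2a_3a_4), and γ = (3σ² − s_2)/(24·a_1a_2a_3a_4). Then for every integer n ≥ 1, (αn² + βn + γ)·n − 16·(a_1a_2a_3a_4)³ < p_A(n,4) < (αn² + βn + γ)·n + 16·(a_1a_2a_3a_4)³. -/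
theorem pA_of_neg (a : ℕ → ℕ) (k : ℕ) {n : ℤ} (hn : n < 0) : pA a k n = 0 := by
  have : {c : Fin k → ℕ | (∑ i, (c i : ℤ) * (a i.val : ℤ)) = n} = ∅ :=
    Set.eq_empty_of_forall_notMem fun c hc => by
      have : 0 ≤ ∑ i, (c i : ℤ) * (a i.val : ℤ) := Finset.sum_nonneg fun i _ => by positivity
      rw [Set.mem_ofPred_eq] at hc
      omega
  rw [pA, this, Set.ncard_empty]

theorem finite_pA_set (a : ℕ → ℕ) (hpos : ∀ i, 0 < a i) (k : ℕ) (n : ℤ) :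
    {c : Fin k → ℕ | (∑ i, (c i : ℤ) * (a i.val : ℤ)) = n}.Finite := by
  refine (Set.finite_Iic (fun _ : Fin k => n.toNat)).subset fun c hc i => ?_
  have h1 : (c i : ℤ) * (a i : ℤ) ≤ ∑ i, (c i : ℤ) * (a i.val : ℤ) :=
    Finset.single_le_sum (f := fun i : Fin k => (c i : ℤ) * (a i.val : ℤ))
      (fun i _ => by positivity) (Finset.mem_univ i)
  have h2 : (1 : ℤ) ≤ a i := by exact_mod_cast hpos i
  have h3 : (c i : ℤ) ≤ n := by
    rw [← show _ = n from hc]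
    nlinarith
  exact Int.le_toNat (by omega) |>.2 h3

theorem pA_succ (a : ℕ → ℕ) (hpos : ∀ i, 0 < a i) (k : ℕ) (n : ℤ) :
    pA a (k + 1) n = pA a (k + 1) (n - a k) + pA a k n := by
  have inj1 : Function.Injective (fun c : Fin (k + 1) → ℕ => c + Pi.single (Fin.last k) 1) :=
    add_left_injective _
  have inj2 : Function.Injective
      (fun c : Fin k → ℕ => (Fin.snoc c 0 : Fin (k + 1) → ℕ)) := fun c d h => by
    ext i
    simpa using congrFun h i.castSucc
  rw [pA, pA, pA,
    ← Set.ncard_image_of_injective {c : Fin (k + 1) → ℕ | ∑ i, (c i : ℤ) * (a i : ℤ) = n - a k} inj1,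
    ← Set.ncard_image_of_injective {c : Fin k → ℕ | ∑ i, (c i : ℤ) * (a i : ℤ) = n} inj2,
    ← Set.ncard_union_eq _ ((finite_pA_set a hpos _ _).image _)
      ((finite_pA_set a hpos _ _).image _)]
  · congr 1
    ext c
    simp only [Set.mem_ofPred_eq, Set.mem_union, Set.mem_image, Fin.sum_univ_castSucc]
    constructor
    · intro h
      rcases Nat.eq_zero_or_pos (c (Fin.last k)) with h0 | h0
      · refine Or.inr ⟨Fin.init c, by simpa [h0, Fin.init] using h, ?_⟩
        rw [← h0, Fin.snoc_init_self]
      · refine Or.inl ⟨c - Pi.single (Fin.last k) 1, ?_, ?_⟩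
        · simp [Fin.castSucc_ne_last, Nat.cast_sub h0] at h ⊢
          linarith
        · ext i
          rcases eq_or_ne i (Fin.last k) with rfl | hi
          · simp; omega
          · simp [hi]
    · rintro (⟨d, h, rfl⟩ | ⟨d, h, rfl⟩)
      · simp [Fin.castSucc_ne_last] at h ⊢
        linarith
      · simpa using h
  · rw [Set.disjoint_left]
    rintro _ ⟨c, -, rfl⟩ ⟨d, -, h⟩
    simpa using congrFun h (Fin.last k)

theorem pA_zero_right (a : ℕ → ℕ) (n : ℤ) : pA a 0 n = if n = 0 then 1 else 0 := by
  split_ifs with h <;> simp [pA, h, eq_comm]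

theorem pA_succ_le (a : ℕ → ℕ) (hpos : ∀ i, 0 < a i) (k n : ℕ) :
    pA a (k + 1) n ≤ (n + 1) ^ k := by
  induction k generalizing n with
  | zero =>
    induction n using Nat.strong_induction_on with
    | _ n ih =>
      rw [pA_succ a hpos, pA_zero_right]
      rcases lt_or_ge n (a 0) with h | h
      · rw [pA_of_neg _ _ (by omega)]
        split_ifs <;> simp
      · have := ih (n - a 0) (by have := hpos 0; omega)
        rw [Nat.cast_sub h] at this
        have := hpos 0
        rw [if_neg (by omega)]
        simpa
  | succ k ihk =>
    induction n using Nat.strong_induction_on with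
    | _ n ih =>
      rw [pA_succ a hpos]
      have h0 := ihk n
      rcases lt_or_ge n (a (k + 1)) with h | h
      · rw [pA_of_neg _ _ (by omega), zero_add]
        exact h0.trans (Nat.pow_le_pow_right (by omega) (by omega))
      · have h2 := hpos (k + 1)
        have h1 := ih (n - a (k + 1)) (by omega)
        rw [Nat.cast_sub h] at h1
        calc _ ≤ (n - a (k + 1) + 1) ^ (k + 1) + (n + 1) ^ k := add_le_add h1 h0
          _ ≤ n * (n + 1) ^ k + (n + 1) ^ k := by
            rw [pow_succ']
            gcongr <;> omega
          _ = (n + 1) ^ (k + 1) := by ring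

open PowerSeries in
theorem mk_pA_succ_mul (a : ℕ → ℕ) (hpos : ∀ i, 0 < a i) (k : ℕ) :
    PowerSeries.mk (fun n : ℕ => (pA a (k + 1) n : ℝ)) * (1 - X ^ a k) =
      PowerSeries.mk (fun n : ℕ => (pA a k n : ℝ)) := by
  ext n
  rw [mul_sub, mul_one, map_sub, coeff_mul_X_pow', coeff_mk, coeff_mk, pA_succ a hpos k n]
  split_ifs with h
  · rw [coeff_mk, Nat.cast_sub h]
    push_cast
    ring
  · rw [pA_of_neg _ _ (by omega)]
    simp

open PowerSeries in
theorem mk_pA_mul_prod (a : ℕ → ℕ) (hpos : ∀ i, 0 < a i) (k : ℕ) :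
    PowerSeries.mk (fun n : ℕ => (pA a k n : ℝ)) * ∏ i ∈ Finset.range k, (1 - X ^ a i) = 1 := by
  induction k with
  | zero =>
    ext n
    simp [pA_zero_right, coeff_one]
  | succ k ih => rw [Finset.prod_range_succ_comm, ← mul_assoc, mk_pA_succ_mul a hpos, ih]

theorem geom_sum_dvd_geom_sum_of_dvd {R : Type*} [CommRing R] (x : R) {m n : ℕ} (h : m ∣ n) :
    ∑ i ∈ Finset.range m, x ^ i ∣ ∑ i ∈ Finset.range n, x ^ i := by
  obtain ⟨q, rfl⟩ := h
  induction q with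
  | zero => simp
  | succ q ih =>
    simp_rw [Nat.mul_succ, Finset.sum_range_add, pow_add, ← Finset.mul_sum]
    exact dvd_add ih (dvd_mul_left _ _)

theorem Nat.Coprime.isCoprime_geom_sum {R : Type*} [CommRing R] (x : R) {m n : ℕ}
    (h : m.Coprime n) :
    IsCoprime (∑ i ∈ Finset.range m, x ^ i) (∑ i ∈ Finset.range n, x ^ i) := by
  induction m, n using Nat.gcd.induction with
  | H0 n =>
    rw [Nat.coprime_zero_left] at h
    simp [h, isCoprime_one_right]
  | H1 m n hm ih =>
    have ih' := ih (by rwa [Nat.Coprime, ← Nat.gcd_rec])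
    obtain ⟨c, hc⟩ := geom_sum_dvd_geom_sum_of_dvd x (Dvd.intro (n / m) rfl : m ∣ m * (n / m))
    have hn : ∑ i ∈ Finset.range n, x ^ i = ∑ i ∈ Finset.range (n % m), x ^ i +
        (∑ i ∈ Finset.range m, x ^ i) * (x ^ (n % m) * c) := by
      conv_lhs => rw [← Nat.mod_add_div n m]
      simp_rw [Finset.sum_range_add, pow_add, ← Finset.mul_sum]
      rw [hc]
      ring
    rw [hn]
    exact ih'.symm.add_mul_left_right _

open Polynomial in
theorem eq_C_eval_one_add_sub_one_mul (p : ℝ[X]) :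
    p = C (p.eval 1) + (X - 1) * (p /ₘ (X - C 1)) := by
  conv_lhs => rw [← modByMonic_add_div p (X - C 1), modByMonic_X_sub_C_eq_C_eval]
  simp

theorem PowerSeries.coeff_of_one_sub_X_pow_three_mul_eq (H : PowerSeries ℝ) (q : Polynomial ℝ)
    (h : (1 - X) ^ 3 * H = (q : PowerSeries ℝ)) {n : ℕ} (hn : q.natDegree < n) :
    coeff n H = q.eval 1 * ((n + 2) * (n + 1) / 2) - q.derivative.eval 1 * (n + 1) +
      q.derivative.derivative.eval 1 / 2 := by
  set q₁ := q /ₘ (Polynomial.X - Polynomial.C 1) with h1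
  set q₂ := q₁ /ₘ (Polynomial.X - Polynomial.C 1) with h2
  set q₃ := q₂ /ₘ (Polynomial.X - Polynomial.C 1) with h3
  have e1 := eq_C_eval_one_add_sub_one_mul q
  have e2 := eq_C_eval_one_add_sub_one_mul q₁
  have e3 := eq_C_eval_one_add_sub_one_mul q₂
  rw [← h1] at e1
  rw [← h2] at e2
  rw [← h3] at e3
  have d1 : q.derivative.eval 1 = q₁.eval 1 := by
    rw [e1]; simp
  have d2 : q.derivative.derivative.eval 1 = 2 * q₂.eval 1 := by
    rw [e1, e2]; simp; ring
  have hd : q₃.natDegree < n := by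
    simp only [h3, h2, h1, Polynomial.natDegree_divByMonic _ (Polynomial.monic_X_sub_C _)]
    omega
  rw [d1, d2]
  generalize q.eval 1 = c₀ at *
  generalize q₁.eval 1 = c₁ at *
  generalize q₂.eval 1 = c₂ at *
  have hE : (mk 1 : PowerSeries ℝ) * (1 - X) = 1 := mk_one_mul_one_sub_eq_one ℝ
  have hq : (q : PowerSeries ℝ) = C c₀ - (1 - X) * C c₁ + (1 - X) ^ 2 * C c₂
      - (1 - X) ^ 3 * (q₃ : PowerSeries ℝ) := by
    rw [e1, e2, e3]
    push_cast
    ring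
  have hH : H = C c₀ * mk 1 ^ (2 + 1) - C c₁ * mk 1 ^ (1 + 1) + C c₂ * mk 1 - (q₃ : PowerSeries ℝ) := by
    calc H = (mk 1 * (1 - X)) ^ 3 * H := by rw [hE]; ring
      _ = mk 1 ^ 3 * ((1 - X) ^ 3 * H) := by ring
      _ = C c₀ * mk 1 ^ 3 - C c₁ * mk 1 ^ 2 * (mk 1 * (1 - X)) +
          C c₂ * mk 1 * (mk 1 * (1 - X)) ^ 2 - (mk 1 * (1 - X)) ^ 3 * (q₃ : PowerSeries ℝ) := by rw [h, hq]; ring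
      _ = _ := by rw [hE]; ring
  rw [hH, mk_one_pow_eq_mk_choose_add, mk_one_pow_eq_mk_choose_add]
  simp only [map_sub, map_add, coeff_C_mul, coeff_mk, Polynomial.coeff_coe,
    Polynomial.coeff_eq_zero_of_natDegree_lt hd, Pi.one_apply]
  rw [Nat.cast_choose_two]
  simp
  ring

open Polynomial in
theorem eval_one_geom_sum (m : ℕ) : (∑ i ∈ Finset.range m, (X : ℝ[X]) ^ i).eval 1 = m := by
  simp [eval_finsetSum]

open Polynomial in
theorem eval_one_derivative_geom_sum (m : ℕ) :
    (∑ i ∈ Finset.range m, (X : ℝ[X]) ^ i).derivative.eval 1 = m * (m - 1) / 2 := by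
  induction m with
  | zero => simp
  | succ m ih =>
    rw [Finset.sum_range_succ, derivative_add, eval_add, ih]
    simp [derivative_X_pow]
    ring

open Polynomial in
theorem eval_one_derivative_derivative_geom_sum (m : ℕ) :
    (∑ i ∈ Finset.range m, (X : ℝ[X]) ^ i).derivative.derivative.eval 1 =
      m * (m - 1) * (m - 2) / 3 := by
  induction m with
  | zero => simp
  | succ m ih =>
    rw [Finset.sum_range_succ, derivative_add, derivative_add, eval_add, ih]
    rcases m with _ | m
    · simp
    · simp [derivative_X_pow]
      ring

open Polynomial in
theorem natDegree_geom_sum_lt {m : ℕ} (hm : 0 < m) :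
    (∑ i ∈ Finset.range m, (X : ℝ[X]) ^ i).natDegree < m := by
  refine (natDegree_sum_le_of_forall_le (n := m - 1) _ _ fun i hi => ?_).trans_lt (by omega)
  rw [natDegree_X_pow]
  have := Finset.mem_range.1 hi
  omega

open Polynomial in
theorem eval_one_of_mul_geom_sum_eq (q : ℝ[X]) (a b c d : ℕ) (ha : 0 < a) (hb : 0 < b)
    (hc : 0 < c) (hd : 0 < d)
    (h : q * ((∑ i ∈ Finset.range a, X ^ i) * (∑ i ∈ Finset.range b, X ^ i) *
      (∑ i ∈ Finset.range c, X ^ i) * (∑ i ∈ Finset.range d, X ^ i)) =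
      ∑ i ∈ Finset.range (a * b * c * d), X ^ i) :
    q.eval 1 = 1 ∧
    q.derivative.eval 1 = (a * b * c * d - (a + b + c + d) + 3) / 2 ∧
    q.derivative.derivative.eval 1 =
      ((a * b * c * d : ℝ) - 1) * (a * b * c * d - 2) / 3 -
        (a * b * c * d - (a + b + c + d) + 3) * (a + b + c + d - 4) / 2 -
        ((a - 1) * (a - 2) + (b - 1) * (b - 2) + (c - 1) * (c - 2) + (d - 1) * (d - 2)) / 3 -
        ((a - 1) * (b - 1) + (a - 1) * (c - 1) + (a - 1) * (d - 1) + (b - 1) * (c - 1) +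
          (b - 1) * (d - 1) + (c - 1) * (d - 1)) / 2 := by
  have h0 := congrArg (eval 1) h
  have h1 := congrArg (fun p => p.derivative.eval 1) h
  have h2 := congrArg (fun p => p.derivative.derivative.eval 1) h
  simp only [derivative_mul, derivative_add, eval_add, eval_mul, eval_one_geom_sum,
    eval_one_derivative_geom_sum, eval_one_derivative_derivative_geom_sum] at h0 h1 h2
  push_cast at h0 h1 h2
  have e0 : q.eval 1 = 1 := by
    apply mul_right_cancel₀ (b := (a * b * c * d : ℝ)) (by positivity)
    linarith
  rw [e0] at h1 h2
  have e1 : q.derivative.eval 1 = (a * b * c * d - (a + b + c + d) + 3) / 2 := by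
    apply mul_right_cancel₀ (b := (a * b * c * d : ℝ)) (by positivity)
    linarith
  rw [e1] at h2
  refine ⟨e0, e1, ?_⟩
  apply mul_right_cancel₀ (b := (a * b * c * d : ℝ)) (by positivity)
  linarith

open Polynomial in
theorem pA_four_add_prod (a : ℕ → ℕ) (hpos : ∀ i, 0 < a i)
    (hgcd : ∀ i j, i < j → j < 4 → Nat.gcd (a i) (a j) = 1) (f : ℝ → ℝ)
    (hf : ∀ x, f x = (x ^ 3 / 6 + (a 0 + a 1 + a 2 + a 3) / 4 * x ^ 2 +
      (3 * ((a 0 : ℝ) + a 1 + a 2 + a 3) ^ 2 - (a 0 ^ 2 + a 1 ^ 2 + a 2 ^ 2 + a 3 ^ 2)) / 24 * x) /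
        (a 0 * a 1 * a 2 * a 3)) (n : ℕ) :
    (pA a 4 (n + a 0 * a 1 * a 2 * a 3 : ℕ) : ℝ) - f (n + a 0 * a 1 * a 2 * a 3 : ℕ) =
      pA a 4 n - f n := by
  have hc : ∀ i j, i < j → j < 4 → IsCoprime (∑ k ∈ Finset.range (a i), (X : ℝ[X]) ^ k)
      (∑ k ∈ Finset.range (a j), X ^ k) :=
    fun i j h h' => Nat.Coprime.isCoprime_geom_sum X (hgcd i j h h')
  have hdvd : ∀ i, a i ∣ a 0 * a 1 * a 2 * a 3 → (∑ k ∈ Finset.range (a i), (X : ℝ[X]) ^ k) ∣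
      ∑ k ∈ Finset.range (a 0 * a 1 * a 2 * a 3), X ^ k :=
    fun i h => geom_sum_dvd_geom_sum_of_dvd X h
  obtain ⟨q, hq⟩ : (∑ i ∈ Finset.range (a 0), (X : ℝ[X]) ^ i) * (∑ i ∈ Finset.range (a 1), X ^ i) *
      (∑ i ∈ Finset.range (a 2), X ^ i) * (∑ i ∈ Finset.range (a 3), X ^ i) ∣
      ∑ i ∈ Finset.range (a 0 * a 1 * a 2 * a 3), X ^ i := by
    refine IsCoprime.mul_dvd (((hc 0 3 ?_ ?_).mul_left (hc 1 3 ?_ ?_)).mul_left (hc 2 3 ?_ ?_))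
      (IsCoprime.mul_dvd ((hc 0 2 ?_ ?_).mul_left (hc 1 2 ?_ ?_))
        (IsCoprime.mul_dvd (hc 0 1 ?_ ?_) (hdvd 0 ?_) (hdvd 1 ?_)) (hdvd 2 ?_)) (hdvd 3 ?_)
    any_goals norm_num
    · exact ⟨a 1 * a 2 * a 3, by ring⟩
    · exact ⟨a 0 * a 2 * a 3, by ring⟩
    · exact ⟨a 0 * a 1 * a 3, by ring⟩
  have h0 := hpos 0
  have h1 := hpos 1
  have h2 := hpos 2
  have h3 := hpos 3
  obtain ⟨e0, e1, e2⟩ := eval_one_of_mul_geom_sum_eq q _ _ _ _ h0 h1 h2 h3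
    (by rw [mul_comm, ← hq])
  have hD : 0 < a 0 * a 1 * a 2 * a 3 := by positivity
  have hdeg : q.natDegree < a 0 * a 1 * a 2 * a 3 := by
    refine (natDegree_le_of_dvd (Dvd.intro_left _ hq.symm) fun h => ?_).trans_lt
      (natDegree_geom_sum_lt hD)
    have := eval_one_geom_sum (a 0 * a 1 * a 2 * a 3)
    rw [h, eval_zero, eq_comm, Nat.cast_eq_zero] at this
    omega
  have hpoly : (1 - X : ℝ[X]) ^ 3 * (1 - X ^ (a 0 * a 1 * a 2 * a 3)) =
      q * ∏ i ∈ Finset.range 4, (1 - X ^ a i) := by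
    simp only [Finset.prod_range_succ, Finset.prod_range_zero, one_mul]
    simp only [← mul_neg_geom_sum]
    rw [hq]
    ring
  have hseries := congrArg (fun p : ℝ[X] => (p : PowerSeries ℝ)) hpoly
  simp only [Finset.prod_range_succ, Finset.prod_range_zero, one_mul] at hseries
  push_cast at hseries
  have hP := mk_pA_mul_prod a hpos 4
  simp only [Finset.prod_range_succ, Finset.prod_range_zero, one_mul] at hP
  set P := PowerSeries.mk (fun n : ℕ => (pA a 4 n : ℝ)) with hPdef
  have key : (1 - PowerSeries.X) ^ 3 * ((1 - PowerSeries.X ^ (a 0 * a 1 * a 2 * a 3)) * P) =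
      (q : PowerSeries ℝ) := by
    rw [← mul_assoc, hseries, mul_assoc, mul_comm _ P, hP, mul_one]
  have hcoeff := PowerSeries.coeff_of_one_sub_X_pow_three_mul_eq _ q key
    (n := n + a 0 * a 1 * a 2 * a 3) (by omega)
  rw [sub_mul, one_mul, map_sub, PowerSeries.coeff_X_pow_mul, hPdef, PowerSeries.coeff_mk,
    PowerSeries.coeff_mk, e0, e1, e2] at hcoeff
  have h0' : (a 0 : ℝ) ≠ 0 := by positivity
  have h1' : (a 1 : ℝ) ≠ 0 := by positivity
  have h2' : (a 2 : ℝ) ≠ 0 := by positivity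
  have h3' : (a 3 : ℝ) ≠ 0 := by positivity
  rw [sub_eq_sub_iff_sub_eq_sub, hcoeff, hf, hf]
  push_cast
  field_simp
  ring

theorem stmt6 (a : ℕ → ℕ) (hpos : ∀ i, 0 < a i) (hmono : StrictMono a)
    (hgcd : ∀ i j, i < j → j < 4 → Nat.gcd (a i) (a j) = 1)
    (σ s2 α β γ : ℝ)
    (hσ : σ = (a 0 : ℝ) + a 1 + a 2 + a 3)
    (hs2 : s2 = (a 0 : ℝ) ^ 2 + (a 1 : ℝ) ^ 2 + (a 2 : ℝ) ^ 2 + (a 3 : ℝ) ^ 2)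
    (hα : α = 1 / ((Nat.factorial 3 : ℝ) * ((a 0 : ℝ) * a 1 * a 2 * a 3)))
    (hβ : β = σ / (4 * ((a 0 : ℝ) * a 1 * a 2 * a 3)))
    (hγ : γ = (3 * σ ^ 2 - s2) / (24 * ((a 0 : ℝ) * a 1 * a 2 * a 3)))
    (n : ℕ) (hn : 1 ≤ n) :
    (α * (n : ℝ) ^ 2 + β * n + γ) * n - 16 * ((a 0 : ℝ) * a 1 * a 2 * a 3) ^ 3 <
        (pA a 4 (n : ℤ) : ℝ) ∧
      (pA a 4 (n : ℤ) : ℝ) <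
        (α * (n : ℝ) ^ 2 + β * n + γ) * n + 16 * ((a 0 : ℝ) * a 1 * a 2 * a 3) ^ 3 := by
  have hper := pA_four_add_prod a hpos hgcd (fun x => (α * x ^ 2 + β * x + γ) * x) (fun x => by
    have h0 := hpos 0
    have h1 := hpos 1
    have h2 := hpos 2
    have h3 := hpos 3
    rw [hα, hβ, hγ, hσ, hs2]
    norm_num [Nat.factorial]
    field_simp)
  set D : ℕ := a 0 * a 1 * a 2 * a 3 with hDdef
  have hDcast : (a 0 : ℝ) * a 1 * a 2 * a 3 = D := by rw [hDdef]; push_cast; rfl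
  have hle : ∀ i, a i ∣ D → (a i : ℝ) ≤ D := fun i h => by
    have : 0 < D := by have := hpos 0; have := hpos 1; have := hpos 2; have := hpos 3; positivity
    exact_mod_cast Nat.le_of_dvd this h
  have hD : (1 : ℝ) ≤ D := by
    have : (1 : ℝ) ≤ a 0 := by exact_mod_cast hpos 0
    exact this.trans (hle 0 ⟨a 1 * a 2 * a 3, by rw [hDdef]; ring⟩)
  have hσ0 : 0 ≤ σ := by rw [hσ]; positivity
  have hσD : σ ≤ 4 * D := by
    have h0 := hle 0 ⟨a 1 * a 2 * a 3, by rw [hDdef]; ring⟩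
    have h1 := hle 1 ⟨a 0 * a 2 * a 3, by rw [hDdef]; ring⟩
    have h2 := hle 2 ⟨a 0 * a 1 * a 3, by rw [hDdef]; ring⟩
    have h3 := hle 3 ⟨a 0 * a 1 * a 2, by rw [hDdef]; ring⟩
    linarith
  have hs0 : 0 ≤ s2 := by rw [hs2]; positivity
  have hs1 : s2 ≤ σ ^ 2 := by
    rw [hs2, hσ]
    have : (0 : ℝ) ≤ a 0 * a 1 + a 0 * a 2 + a 0 * a 3 + a 1 * a 2 + a 1 * a 3 + a 2 * a 3 := by
      positivity
    linarith
  rw [hDcast] at hα hβ hγ ⊢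
  have hα' : α ≤ 1 / D ∧ 0 ≤ α := by
    rw [hα]
    refine ⟨one_div_le_one_div_of_le (by linarith) ?_, by positivity⟩
    norm_num [Nat.factorial]
    linarith
  have hβ' : β ≤ 1 ∧ 0 ≤ β := by
    rw [hβ]
    exact ⟨(div_le_one (by linarith)).2 hσD, by positivity⟩
  have hγ' : γ ≤ 2 * D ∧ 0 ≤ γ := by
    rw [hγ]
    refine ⟨(div_le_iff₀ (by linarith)).2 ?_, div_nonneg (by nlinarith) (by linarith)⟩
    nlinarith
  have base : ∀ r : ℕ, r < D → |(pA a 4 r : ℝ) - (α * r ^ 2 + β * r + γ) * r| < 16 * (D : ℝ) ^ 3 := by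
    intro r hr
    have hr' : (r : ℝ) ≤ D := by exact_mod_cast hr.le
    have hr0 : (0 : ℝ) ≤ r := by positivity
    have hp : (pA a 4 r : ℝ) ≤ (D : ℝ) ^ 3 := by
      exact_mod_cast (pA_succ_le a hpos 3 r).trans (Nat.pow_le_pow_left hr 3)
    have hp0 : (0 : ℝ) ≤ pA a 4 r := by positivity
    have hf0 : 0 ≤ (α * r ^ 2 + β * r + γ) * r := by
      have := hα'.2; have := hβ'.2; have := hγ'.2
      positivity
    have hf1 : (α * r ^ 2 + β * r + γ) * r ≤ 4 * (D : ℝ) ^ 3 := by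
      have : α * r ^ 2 ≤ 1 / D * (D : ℝ) ^ 2 :=
        mul_le_mul hα'.1 (by gcongr) (by positivity) (by positivity)
      have : 1 / D * (D : ℝ) ^ 2 = D := by field_simp
      have : β * r ≤ 1 * D := mul_le_mul hβ'.1 hr' hr0 (by norm_num)
      have : α * r ^ 2 + β * r + γ ≤ 4 * D := by linarith [hγ'.1]
      calc _ ≤ (4 * D : ℝ) * D := mul_le_mul this hr' hr0 (by positivity)
        _ ≤ (4 * D : ℝ) * D * D := le_mul_of_one_le_right (by positivity) hD
        _ = 4 * (D : ℝ) ^ 3 := by ring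
    have : 0 < (D : ℝ) ^ 3 := by positivity
    rw [abs_lt]
    constructor <;> linarith
  have all : ∀ q r : ℕ, r < D → |(pA a 4 (r + D * q : ℕ) : ℝ) -
      (α * (r + D * q : ℕ) ^ 2 + β * (r + D * q : ℕ) + γ) * (r + D * q : ℕ)| < 16 * (D : ℝ) ^ 3 := by
    intro q r hr
    induction q with
    | zero => exact base r hr
    | succ q ih =>
      rw [Nat.mul_succ, ← add_assoc]
      exact (congrArg abs (hper (r + D * q))).trans_lt ih
  have hn' := all (n / D) (n % D) (Nat.mod_lt _ (by exact_mod_cast zero_lt_one.trans_le hD))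
  rw [Nat.mod_add_div, abs_lt] at hn'
  constructor <;> linarith [hn'.1, hn'.2]
end

section
/- Let A = (a_i)_{i≥1} be a strictly increasing sequence of positive integers such that gcd(a_i, a_j) = 1 for all 1 ≤ i < j ≤ 4. Then for every integer n ≥ 288·(a_1a_2a_3a_4)⁴, one has p_A(n,4)² > (1 + 1/n²)·p_A(n+1,4)·p_A(n−1,4). In particular, p_A(n,4)² > p_A(n+1,4)·p_A(n−1,4) for all integers n ≥ 192·(a_1a_2a_3a_4)⁴. -/
/-- Splitting natural numbers by quotient and remainder, coordinatewise. -/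
def piDivModEquiv {ι : Type*} (Q : ι → ℕ) [∀ i, NeZero (Q i)] :
    (ι → ℕ) ≃ (∀ i, Fin (Q i)) × (ι → ℕ) where
  toFun c := (fun i => (Nat.divModEquiv (Q i) (c i)).2, fun i => (Nat.divModEquiv (Q i) (c i)).1)
  invFun p := fun i => (Nat.divModEquiv (Q i)).symm (p.2 i, p.1 i)
  left_inv c := by
    funext i
    exact (Nat.divModEquiv (Q i)).symm_apply_apply (c i)
  right_inv p := by
    have h i := (Nat.divModEquiv (Q i)).apply_symm_apply (p.2 i, p.1 i)
    exact Prod.ext (funext fun i => congrArg Prod.snd (h i))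
      (funext fun i => congrArg Prod.fst (h i))

/-- The number represented by a tuple of multiplicities. -/
def weight {ι : Type*} [Fintype ι] {Q : ι → ℕ} (a : ι → ℕ) (u : ∀ i, Fin (Q i)) : ℕ :=
  ∑ i, a i * (u i : ℕ)

lemma natCard_sum_eq {ι : Type*} [Fintype ι] (m : ℕ) :
    Nat.card {k : ι → ℕ // ∑ i, k i = m} = (Fintype.card ι + m - 1).choose m := by
  classical
  rw [Nat.card_congr (Sym.equivNatSumOfFintype ι m).symm, Sym.natCard_sym_eq_choose,
    Nat.card_eq_fintype_card]

lemma finite_sum_eq {ι : Type*} [Fintype ι] (m : ℕ) :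
    Finite {k : ι → ℕ // ∑ i, k i = m} := by
  classical
  exact Finite.of_equiv _ (Sym.equivNatSumOfFintype ι m)

lemma natCard_weight_add_eq {ι : Type*} [Fintype ι] {P : ℕ} (hP : 0 < P) (s n : ℕ) (hs : s ≤ n) :
    Nat.card {k : ι → ℕ // s + P * ∑ i, k i = n} =
      if s ≡ n [MOD P] then (Fintype.card ι + (n - s) / P - 1).choose ((n - s) / P) else 0 := by
  split_ifs with h
  · obtain ⟨m, hm⟩ := (Nat.modEq_iff_dvd' hs).1 h
    rw [hm, Nat.mul_div_cancel_left _ hP, ← natCard_sum_eq]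
    refine Nat.card_congr (Equiv.subtypeEquivRight fun k => ?_)
    rw [← Nat.mul_right_inj hP.ne' (a := P) (c := m), ← hm]
    omega
  · rw [Nat.card_eq_zero]
    refine Or.inl ⟨fun k => h ?_⟩
    rw [← k.2]
    simp [Nat.ModEq]

lemma finite_weight_add_eq {ι : Type*} [Fintype ι] {P : ℕ} (hP : 0 < P) (s n : ℕ) :
    Finite {k : ι → ℕ // s + P * ∑ i, k i = n} := by
  have := finite_sum_eq (ι := ι) ((n - s) / P)
  refine Finite.of_injective
    (β := {k : ι → ℕ // ∑ i, k i = (n - s) / P}) (fun k => ⟨k.1, ?_⟩) fun k l h => ?_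
  · exact (Nat.div_eq_of_eq_mul_right hP (Nat.sub_eq_of_eq_add' k.2.symm)).symm
  · exact Subtype.ext (Subtype.mk.inj h)

lemma natCard_partitions {ι : Type*} [Fintype ι] [DecidableEq ι] (a Q : ι → ℕ) [∀ i, NeZero (Q i)] {P : ℕ}
    (hP : 0 < P) (hQ : ∀ i, a i * Q i = P) (n : ℕ) :
    Nat.card {c : ι → ℕ // ∑ i, c i * a i = n} =
      ∑ u : ∀ i, Fin (Q i), Nat.card {k : ι → ℕ // weight a u + P * ∑ i, k i = n} := by
  have (u : ∀ i, Fin (Q i)) := finite_weight_add_eq (ι := ι) hP (weight a u) n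
  rw [← Nat.card_sigma]
  refine Nat.card_congr (Equiv.trans ?_ (Equiv.subtypeProdEquivSigmaSubtype _))
  refine ((piDivModEquiv Q).symm.subtypeEquiv fun p => ?_).symm
  have : ∑ i, (piDivModEquiv Q).symm p i * a i = weight a p.1 + P * ∑ i, p.2 i := by
    rw [weight, Finset.mul_sum, ← Finset.sum_add_distrib]
    refine Finset.sum_congr rfl fun i _ => ?_
    have : (piDivModEquiv Q).symm p i = p.2 i * Q i + (p.1 i : ℕ) := rfl
    rw [this, ← hQ i]
    ring
  rw [this]

lemma weight_add {ι : Type*} [Fintype ι] {a Q : ι → ℕ} [∀ i, NeZero (Q i)] {P : ℕ}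
    (hQ : ∀ i, a i * Q i = P) (u t : ∀ i, Fin (Q i)) :
    weight a (u + t) ≡ weight a u + weight a t [MOD P] := by
  rw [weight, weight, weight, ← Finset.sum_add_distrib]
  refine Nat.ModEq.sum fun i _ => ?_
  rw [Pi.add_apply, Fin.val_add, ← mul_add, ← hQ i]
  exact (Nat.mod_modEq _ _).mul_left' _

/-- If `t` has weight `1` modulo `P`, sums of `t`-invariant functions over residue classes of the
weight do not depend on the residue class. -/
lemma sum_ite_weight_const {ι : Type*} [Fintype ι] [DecidableEq ι] {a Q : ι → ℕ}
    [∀ i, NeZero (Q i)] {P : ℕ}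
    (hQ : ∀ i, a i * Q i = P) (t : ∀ i, Fin (Q i)) (ht : weight a t ≡ 1 [MOD P])
    (g : (∀ i, Fin (Q i)) → ℝ) (hg : ∀ u, g (u + t) = g u) (n : ℕ) :
    ∑ u, (if weight a u ≡ n [MOD P] then g u else 0) =
      ∑ u, (if weight a u ≡ 0 [MOD P] then g u else 0) := by
  induction n with
  | zero => rfl
  | succ n ih =>
    rw [← ih, ← Equiv.sum_comp (Equiv.addRight t)]
    refine Finset.sum_congr rfl fun u _ => ?_
    have h : weight a (u + t) ≡ n + 1 [MOD P] ↔ weight a u ≡ n [MOD P] := by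
      have h1 : weight a (u + t) ≡ weight a u + 1 [MOD P] :=
        (weight_add hQ u t).trans (Nat.ModEq.add_left _ ht)
      exact ⟨fun h => Nat.ModEq.add_right_cancel' 1 (h1.symm.trans h),
        fun h => h1.trans (h.add_right 1)⟩
    simp only [Equiv.coe_addRight, h, hg]

lemma exists_mul_add_mul_modEq_one {a b : ℕ} (h : a.Coprime b) (P : ℕ) [NeZero P] :
    ∃ x y : ℕ, a * x + b * y ≡ 1 [MOD P] := by
  have hb : (a : ℤ) * a.gcdA b + b * a.gcdB b = 1 := by
    rw [← Nat.gcd_eq_gcd_ab, h.gcd_eq_one, Nat.cast_one]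
  refine ⟨((a.gcdA b : ℤ) : ZMod P).val, ((a.gcdB b : ℤ) : ZMod P).val, ?_⟩
  rw [← ZMod.natCast_eq_natCast_iff]
  push_cast
  rw [ZMod.natCast_zmod_val, ZMod.natCast_zmod_val]
  exact_mod_cast congrArg (Int.cast : ℤ → ZMod P) hb

lemma exists_weight_modEq_one {ι : Type*} [Fintype ι] [DecidableEq ι] {a Q : ι → ℕ}
    [∀ i, NeZero (Q i)] {P : ℕ} [NeZero P]
    (hQ : ∀ i, a i * Q i = P) {k l : ι} (h : (a k).Coprime (a l)) :
    ∃ t : ∀ i, Fin (Q i), weight a t ≡ 1 [MOD P] ∧ ∀ i, i ≠ k → i ≠ l → t i = 0 := by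
  obtain ⟨x, y, hxy⟩ := exists_mul_add_mul_modEq_one h P
  have hmod (i : ι) (z : ℕ) : a i * (z % Q i) ≡ a i * z [MOD P] := by
    rw [← hQ i]
    exact (Nat.mod_modEq _ _).mul_left' _
  refine ⟨Pi.single k (Fin.ofNat (Q k) x) + Pi.single l (Fin.ofNat (Q l) y), ?_, ?_⟩
  · have hs (j : ι) (z : ℕ) : weight a (Pi.single j (Fin.ofNat (Q j) z) : ∀ i, Fin (Q i)) =
        a j * (z % Q j) := by
      rw [weight, Finset.sum_eq_single j]
      · simp
      · intro i _ hi
        simp [Pi.single_eq_of_ne hi]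
      · simp
    refine (weight_add hQ _ _).trans (Nat.ModEq.trans ?_ hxy)
    rw [hs, hs]
    exact (hmod k x).add (hmod l y)
  · intro i hk hl
    simp [Pi.single_eq_of_ne hk, Pi.single_eq_of_ne hl]

lemma sum_ite_weight_const_of_pairwise {a Q : Fin 4 → ℕ} [∀ i, NeZero (Q i)] {P : ℕ} [NeZero P]
    (hQ : ∀ i, a i * Q i = P) (ha : ∀ i j, i ≠ j → (a i).Coprime (a j)) (i j : Fin 4)
    (g : (∀ i, Fin (Q i)) → ℝ) (hg : ∀ u v, u i = v i → u j = v j → g u = g v) (n : ℕ) :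
    ∑ u, (if weight a u ≡ n [MOD P] then g u else 0) =
      ∑ u, (if weight a u ≡ 0 [MOD P] then g u else 0) := by
  obtain ⟨k, l, hkl, hik, hil, hjk, hjl⟩ :
      ∃ k l : Fin 4, k ≠ l ∧ i ≠ k ∧ i ≠ l ∧ j ≠ k ∧ j ≠ l := by
    clear hg
    revert i j
    decide
  obtain ⟨t, ht, h0⟩ := exists_weight_modEq_one hQ (ha k l hkl)
  refine sum_ite_weight_const hQ t ht g (fun u => hg _ _ ?_ ?_) n
  · simp [h0 i hik hil]
  · simp [h0 j hjk hjl]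

/-- The moments of the weight over a residue class modulo `P`. -/
noncomputable def weightMoment {ι : Type*} [Fintype ι] [DecidableEq ι] (a Q : ι → ℕ)
    (P r n : ℕ) : ℝ :=
  ∑ u : ∀ i, Fin (Q i), if weight a u ≡ n [MOD P] then (weight a u : ℝ) ^ r else 0

section Moments

variable {a Q : Fin 4 → ℕ} {P : ℕ}

lemma weight_le (hQ : ∀ i, a i * Q i = P) (u : ∀ i, Fin (Q i)) : weight a u ≤ 4 * P := by
  calc weight a u ≤ ∑ _i : Fin 4, P :=
        Finset.sum_le_sum fun i _ => by
          rw [← hQ i]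
          exact Nat.mul_le_mul_left _ (u i).2.le
    _ = 4 * P := by simp

lemma weightMoment_nonneg (r n : ℕ) : 0 ≤ weightMoment a Q P r n :=
  Finset.sum_nonneg fun u _ => by positivity

lemma weightMoment_le (hQ : ∀ i, a i * Q i = P) (r n : ℕ) :
    weightMoment a Q P r n ≤ (4 * P) ^ r * weightMoment a Q P 0 n := by
  rw [weightMoment, weightMoment, Finset.mul_sum]
  refine Finset.sum_le_sum fun u _ => ?_
  split_ifs
  · rw [pow_zero, mul_one]
    have : (weight a u : ℝ) ≤ 4 * P := by exact_mod_cast weight_le hQ u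
    gcongr
  · simp

variable [∀ i, NeZero (Q i)]

lemma weightMoment_zero_pos : 0 < weightMoment a Q P 0 0 := by
  refine Finset.sum_pos' (fun u _ => by positivity) ⟨0, Finset.mem_univ _, ?_⟩
  rw [if_pos (by simp [weight, Nat.ModEq]), pow_zero]
  exact one_pos

variable [NeZero P]

lemma weightMoment_zero_const (hQ : ∀ i, a i * Q i = P)
    (ha : ∀ i j, i ≠ j → (a i).Coprime (a j)) (n : ℕ) :
    weightMoment a Q P 0 n = weightMoment a Q P 0 0 :=
  sum_ite_weight_const_of_pairwise hQ ha 0 0 _ (fun _ _ _ _ => by simp) n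

lemma weightMoment_one_const (hQ : ∀ i, a i * Q i = P)
    (ha : ∀ i j, i ≠ j → (a i).Coprime (a j)) (n : ℕ) :
    weightMoment a Q P 1 n = weightMoment a Q P 1 0 := by
  have h (n : ℕ) : weightMoment a Q P 1 n = ∑ i, ∑ u : ∀ i, Fin (Q i),
      if weight a u ≡ n [MOD P] then (a i : ℝ) * (u i : ℕ) else 0 := by
    rw [weightMoment, Finset.sum_comm]
    refine Finset.sum_congr rfl fun u _ => ?_
    split_ifs
    · rw [pow_one, weight]
      push_cast
      rfl
    · simp
  rw [h, h]
  refine Finset.sum_congr rfl fun i _ => ?_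
  exact sum_ite_weight_const_of_pairwise hQ ha i i (fun u => (a i : ℝ) * (u i : ℕ))
    (fun u v hu _ => by simp only [hu]) n

lemma weightMoment_two_const (hQ : ∀ i, a i * Q i = P)
    (ha : ∀ i j, i ≠ j → (a i).Coprime (a j)) (n : ℕ) :
    weightMoment a Q P 2 n = weightMoment a Q P 2 0 := by
  have h (n : ℕ) : weightMoment a Q P 2 n = ∑ i, ∑ j, ∑ u : ∀ i, Fin (Q i),
      if weight a u ≡ n [MOD P] then ((a i : ℝ) * (u i : ℕ)) * ((a j : ℝ) * (u j : ℕ)) else 0 := by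
    rw [weightMoment]
    simp_rw [Finset.sum_comm (s := (Finset.univ : Finset (Fin 4)))
      (t := (Finset.univ : Finset (∀ i, Fin (Q i))))]
    refine Finset.sum_congr rfl fun u _ => ?_
    split_ifs
    · rw [sq, weight]
      push_cast
      rw [Finset.sum_mul_sum]
    · simp
  rw [h, h]
  refine Finset.sum_congr rfl fun i _ => Finset.sum_congr rfl fun j _ => ?_
  exact sum_ite_weight_const_of_pairwise hQ ha i j
    (fun u => ((a i : ℝ) * (u i : ℕ)) * ((a j : ℝ) * (u j : ℕ)))
    (fun u v hu hv => by simp only [hu, hv]) n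

lemma natCard_partitions_eq_moments (hQ : ∀ i, a i * Q i = P) (n : ℕ) (hn : 4 * P ≤ n) :
    6 * (P : ℝ) ^ 3 * Nat.card {c : Fin 4 → ℕ // ∑ i, c i * a i = n} =
      (n + P) * (n + 2 * P) * (n + 3 * P) * weightMoment a Q P 0 n
      - (3 * n ^ 2 + 12 * P * n + 11 * P ^ 2) * weightMoment a Q P 1 n
      + (3 * n + 6 * P) * weightMoment a Q P 2 n - weightMoment a Q P 3 n := by
  have hP : 0 < P := Nat.pos_of_neZero P
  rw [natCard_partitions a Q hP hQ, Finset.sum_congr rfl fun u _ =>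
    natCard_weight_add_eq hP _ _ ((weight_le hQ u).trans hn)]
  simp only [weightMoment, Nat.cast_sum, Finset.mul_sum, ← Finset.sum_add_distrib,
    ← Finset.sum_sub_distrib]
  refine Finset.sum_congr rfl fun u _ => ?_
  have hs : weight a u ≤ n := (weight_le hQ u).trans hn
  split_ifs with h
  · obtain ⟨m, hm⟩ := (Nat.modEq_iff_dvd' hs).1 h
    rw [hm, Nat.mul_div_cancel_left _ hP]
    have hn' : (n : ℝ) = weight a u + P * m := by
      exact_mod_cast (show n = weight a u + P * m by omega)
    have hc : 6 * (((Fintype.card (Fin 4) + m - 1).choose m : ℕ) : ℝ) =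
        (m + 1) * (m + 2) * (m + 3) := by
      rw [Fintype.card_fin, show 4 + m - 1 = m + 3 by omega, Nat.choose_symm_add]
      have := Nat.descFactorial_eq_factorial_mul_choose (m + 3) 3
      simp only [Nat.descFactorial, Nat.factorial] at this
      have h2 : 6 * (m + 3).choose 3 = (m + 1) * (m + 2) * (m + 3) := by
        simp at this
        linarith
      exact_mod_cast h2
    rw [hn']
    linear_combination (P : ℝ) ^ 3 * hc
  · simp

lemma natCard_partitions_eq_cubic (hQ : ∀ i, a i * Q i = P)
    (ha : ∀ i j, i ≠ j → (a i).Coprime (a j)) :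
    ∃ W B C : ℝ, 0 < W ∧ |B| ≤ 6 * P ∧ |C| ≤ 59 * P ^ 2 ∧ ∀ n : ℕ, 4 * P ≤ n →
      ∃ e : ℝ, |e| ≤ 210 * P ^ 3 ∧
        (Nat.card {c : Fin 4 → ℕ // ∑ i, c i * a i = n} : ℝ) =
          W * (n ^ 3 + B * n ^ 2 + C * n + e) := by
  have hP : (0 : ℝ) < P := by exact_mod_cast Nat.pos_of_neZero P
  have hM : 0 < weightMoment a Q P 0 0 := weightMoment_zero_pos
  set M := weightMoment a Q P 0 0 with hMdef
  have bound (r n : ℕ) : 0 ≤ weightMoment a Q P r n / M ∧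
      weightMoment a Q P r n / M ≤ (4 * P) ^ r := by
    refine ⟨div_nonneg (weightMoment_nonneg r n) hM.le, ?_⟩
    rw [div_le_iff₀ hM, hMdef, ← weightMoment_zero_const hQ ha n]
    exact weightMoment_le hQ r n
  obtain ⟨l1, u1⟩ := bound 1 0
  obtain ⟨l2, u2⟩ := bound 2 0
  set x := weightMoment a Q P 1 0 / M with hx
  set y := weightMoment a Q P 2 0 / M with hy
  rw [pow_one] at u1
  have hPx : 0 ≤ P * x := by positivity
  have hPx' : P * x ≤ P * (4 * P) := by gcongr
  have hPPx : 0 ≤ P ^ 2 * x := by positivity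
  have hPPx' : P ^ 2 * x ≤ P ^ 2 * (4 * P) := by gcongr
  have hPy : 0 ≤ P * y := by positivity
  have hPy' : P * y ≤ P * (4 * P) ^ 2 := by gcongr
  have hP3 : 0 < (P : ℝ) ^ 3 := by positivity
  refine ⟨M / (6 * P ^ 3), 6 * P - 3 * x, 11 * P ^ 2 - 12 * P * x + 3 * y, by positivity,
    ?_, ?_, fun n hn => ?_⟩
  · rw [abs_le]
    constructor <;> linarith
  · rw [abs_le]
    constructor <;> nlinarith
  · obtain ⟨l3, u3⟩ := bound 3 n
    set z := weightMoment a Q P 3 n / M with hz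
    refine ⟨6 * P ^ 3 - 11 * P ^ 2 * x + 6 * P * y - z, ?_, ?_⟩
    · rw [abs_le]
      constructor <;> nlinarith
    · have key := natCard_partitions_eq_moments hQ n hn
      rw [weightMoment_zero_const hQ ha, weightMoment_one_const hQ ha,
        weightMoment_two_const hQ ha, ← hMdef, ← div_mul_cancel₀ (weightMoment a Q P 1 0) hM.ne',
        ← div_mul_cancel₀ (weightMoment a Q P 2 0) hM.ne',
        ← div_mul_cancel₀ (weightMoment a Q P 3 n) hM.ne', ← hx, ← hy, ← hz] at key
      rw [div_mul_eq_mul_div, eq_div_iff (by positivity)]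
      linear_combination key

end Moments

lemma pA_four_eq_natCard (a : ℕ → ℕ) (n : ℕ) :
    pA a 4 n = Nat.card {c : Fin 4 → ℕ // ∑ i, c i * a i = n} := by
  rw [pA, ← Nat.card_coe_set_eq]
  refine Nat.card_congr (Equiv.subtypeEquivRight fun c => ?_)
  rw [Set.mem_ofPred_eq]
  norm_cast

/-- A cubic with small lower-order coefficients and small perturbations is log-concave at `x`. -/
lemma perturbed_cubic_log_concave {x B C e e₁ e₂ : ℝ} (hx : 1000 ≤ x)
    (hB : |B| ≤ x / 27) (hC : |C| ≤ x / 27)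
    (he : |e| ≤ x / 27) (h₁ : |e₁| ≤ x / 27) (h₂ : |e₂| ≤ x / 27) :
    (1 + 1 / x ^ 2) * ((x + 1) ^ 3 + B * (x + 1) ^ 2 + C * (x + 1) + e₁) *
      ((x - 1) ^ 3 + B * (x - 1) ^ 2 + C * (x - 1) + e₂) <
      (x ^ 3 + B * x ^ 2 + C * x + e) ^ 2 := by
  have hx0 : 0 < x := by linarith
  have prod {u v U V : ℝ} (hu : |u| ≤ U) (hv : |v| ≤ V) : |u * v| ≤ U * V := by
    rw [abs_mul]
    exact mul_le_mul hu hv (abs_nonneg v) ((abs_nonneg u).trans hu)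
  have x2 : 1000 * x ≤ x ^ 2 := by nlinarith
  have x3 : 1000 * x ^ 2 ≤ x ^ 3 := by nlinarith [sq_nonneg x]
  have x4 : 1000 * x ^ 3 ≤ x ^ 4 := by nlinarith [pow_pos hx0 3]
  have habs (k : ℕ) : |x ^ k| ≤ x ^ k := (abs_of_pos (pow_pos hx0 k)).le
  have hx1 : |x| ≤ x := (abs_of_pos hx0).le
  have hBx := abs_le.1 (prod hB hx1)
  have hBx2 := abs_le.1 (prod hB (habs 2))
  have hBx3 := abs_le.1 (prod hB (habs 3))
  have hCx := abs_le.1 (prod hC hx1)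
  have hBC := prod hB hC
  have hBCx := abs_le.1 (prod hBC hx1)
  have hB' := abs_le.1 hB
  have hC' := abs_le.1 hC
  have he' := abs_le.1 he
  have h₁' := abs_le.1 h₁
  have h₂' := abs_le.1 h₂
  set q := x ^ 3 + B * x ^ 2 + C * x with hq
  set d := 3 * x ^ 2 + 1 + 2 * B * x + C with hd
  set g := 3 * x + B with hg
  clear_value q d g
  have hqb : |q| ≤ 1.05 * x ^ 3 := by
    rw [abs_le]
    constructor <;> linarith
  have hgb : |g| ≤ 4 * x := by
    rw [abs_le]
    constructor <;> linarith
  have hdb₁ : |g - d| ≤ 4 * x ^ 2 := by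
    rw [abs_le]
    constructor <;> linarith
  have hdb₂ : |g + d| ≤ 4 * x ^ 2 := by
    rw [abs_le]
    constructor <;> linarith
  have hqb' := abs_le.1 hqb
  have hdb₁' := abs_le.1 hdb₁
  have hdb₂' := abs_le.1 hdb₂
  have hF₁ : |q + (g + d) + e₁| ≤ 1.1 * x ^ 3 := by
    rw [abs_le]
    constructor <;> linarith
  have hF₂ : |q + (g - d) + e₂| ≤ 1.1 * x ^ 3 := by
    rw [abs_le]
    constructor <;> linarith
  have hee : |2 * e - e₁ - e₂| ≤ 4 * (x / 27) := by
    rw [abs_le]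
    constructor <;> linarith
  have t1 := abs_le.1 (prod hqb hee)
  have t2 := abs_le.1 (prod h₁ hdb₁)
  have t3 := abs_le.1 (prod h₂ hdb₂)
  have t4 := abs_le.1 (prod h₁ h₂)
  have t5 := abs_le.1 (prod hgb hgb)
  have t6 := abs_le.1 (prod hF₁ hF₂)
  have quad : d ^ 2 - 2 * q * g = 3 * x ^ 4 + 4 * (B * x ^ 3) + 2 * (B * x) ^ 2 + 6 * x ^ 2
      + 4 * (B * x) + 2 * (B * C * x) + (1 + C) ^ 2 := by
    rw [hd, hq, hg]
    ring
  have diff : (q + e) ^ 2 - (q + (g + d) + e₁) * (q + (g - d) + e₂) =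
      q * (2 * e - e₁ - e₂) + e ^ 2 + (d ^ 2 - 2 * q * g) - g * g - e₁ * (g - d) - e₂ * (g + d)
        - e₁ * e₂ := by ring
  have lower : 2 * x ^ 4 ≤ (q + e) ^ 2 - (q + (g + d) + e₁) * (q + (g - d) + e₂) := by
    rw [diff, quad]
    linarith [sq_nonneg (B * x), sq_nonneg (1 + C), sq_nonneg e]
  have upper : (q + (g + d) + e₁) * (q + (g - d) + e₂) / x ^ 2 ≤ 1.21 * x ^ 4 := by
    rw [div_le_iff₀ (by positivity)]
    linarith [t6.2]
  have e₁_eq : (x + 1) ^ 3 + B * (x + 1) ^ 2 + C * (x + 1) + e₁ = q + (g + d) + e₁ := by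
    rw [hd, hq, hg]
    ring
  have e₂_eq : (x - 1) ^ 3 + B * (x - 1) ^ 2 + C * (x - 1) + e₂ = q + (g - d) + e₂ := by
    rw [hd, hq, hg]
    ring
  rw [e₁_eq, e₂_eq]
  calc (1 + 1 / x ^ 2) * (q + (g + d) + e₁) * (q + (g - d) + e₂)
      = (q + (g + d) + e₁) * (q + (g - d) + e₂)
        + (q + (g + d) + e₁) * (q + (g - d) + e₂) / x ^ 2 := by ring
    _ < (q + e) ^ 2 := by linarith [pow_pos hx0 4]

theorem stmt7 (a : ℕ → ℕ) (hpos : ∀ i, 0 < a i) (hmono : StrictMono a)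
    (hgcd : ∀ i j, i < j → j < 4 → Nat.gcd (a i) (a j) = 1) :
    (∀ n : ℕ, 288 * (a 0 * a 1 * a 2 * a 3) ^ 4 ≤ n →
      (1 + 1 / (n : ℝ) ^ 2) * (pA a 4 ((n : ℤ) + 1) : ℝ) * (pA a 4 ((n : ℤ) - 1) : ℝ) <
        (pA a 4 (n : ℤ) : ℝ) ^ 2) ∧
    (∀ n : ℕ, 192 * (a 0 * a 1 * a 2 * a 3) ^ 4 ≤ n →
      pA a 4 ((n : ℤ) + 1) * pA a 4 ((n : ℤ) - 1) < pA a 4 (n : ℤ) ^ 2) := by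
  have key : ∀ n : ℕ, 192 * (a 0 * a 1 * a 2 * a 3) ^ 4 ≤ n →
      (1 + 1 / (n : ℝ) ^ 2) * (pA a 4 ((n : ℤ) + 1) : ℝ) * (pA a 4 ((n : ℤ) - 1) : ℝ) <
        (pA a 4 (n : ℤ) : ℝ) ^ 2 := by
    intro n hn
    have p0 := hpos 0
    have p1 := hpos 1
    have p2 := hpos 2
    have p3 := hpos 3
    have m1 : a 0 < a 1 := hmono (by norm_num)
    have m2 : a 1 < a 2 := hmono (by norm_num)
    have m3 : a 2 < a 3 := hmono (by norm_num)
    have h30 : 30 ≤ a 0 * a 1 * a 2 * a 3 := by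
      have h3 : 3 ≤ a 2 := by omega
      have h5 : 5 ≤ a 3 := by
        by_contra! h
        have e1 : a 1 = 2 := by omega
        have e3 : a 3 = 4 := by omega
        have := hgcd 1 3 (by norm_num) (by norm_num)
        simp [e1, e3] at this
      calc 30 = 1 * 2 * 3 * 5 := by norm_num
        _ ≤ _ := by gcongr <;> omega
    set P := a 0 * a 1 * a 2 * a 3 with hP
    let Q : Fin 4 → ℕ := ![a 1 * a 2 * a 3, a 0 * a 2 * a 3, a 0 * a 1 * a 3, a 0 * a 1 * a 2]
    have : NeZero P := ⟨by omega⟩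
    have : ∀ i, NeZero (Q i) := by
      intro i
      refine ⟨ne_of_gt ?_⟩
      fin_cases i <;> simp [Q] <;> simp [p0, p1, p2, p3]
    have hQ : ∀ i : Fin 4, a i * Q i = P := by
      intro i
      fin_cases i <;> simp [Q, hP] <;> ring
    have ha : ∀ i j : Fin 4, i ≠ j → (a i).Coprime (a j) := by
      intro i j hij
      rcases lt_or_gt_of_ne hij with h | h
      · exact hgcd i j h j.2
      · exact Nat.Coprime.symm (hgcd j i h i.2)
    obtain ⟨W, B, C, hW, hB, hC, hf⟩ :=
      natCard_partitions_eq_cubic (a := fun i : Fin 4 => a i) hQ ha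
    have hPn : 5760 * P ^ 3 ≤ n := by
      calc 5760 * P ^ 3 = 192 * (30 * P ^ 3) := by ring
        _ ≤ 192 * (P * P ^ 3) := by gcongr
        _ = 192 * P ^ 4 := by ring
        _ ≤ n := hn
    have hP1 : P ≤ P ^ 3 := Nat.le_self_pow (by norm_num) P
    have hP30 : 30 * P ^ 2 ≤ P ^ 3 := by
      calc 30 * P ^ 2 ≤ P * P ^ 2 := by gcongr
        _ = P ^ 3 := by ring
    obtain ⟨n, rfl⟩ : ∃ m, n = m + 1 := ⟨n - 1, by omega⟩
    obtain ⟨e, he, h0⟩ := hf (n + 1) (by omega)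
    obtain ⟨e₁, he₁, h1⟩ := hf (n + 2) (by omega)
    obtain ⟨e₂, he₂, h2⟩ := hf n (by omega)
    rw [show ((n + 1 : ℕ) : ℤ) + 1 = ((n + 2 : ℕ) : ℤ) by push_cast; ring,
      show ((n + 1 : ℕ) : ℤ) - 1 = (n : ℤ) by push_cast; ring,
      pA_four_eq_natCard, pA_four_eq_natCard, pA_four_eq_natCard, h0, h1, h2]
    have hPn' : 5760 * (P : ℝ) ^ 3 ≤ (n + 1 : ℕ) := by exact_mod_cast hPn
    have hP1' : (P : ℝ) ≤ P ^ 3 := by exact_mod_cast hP1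
    have hP30' : 30 * (P : ℝ) ^ 2 ≤ P ^ 3 := by exact_mod_cast hP30
    have hP' : (30 : ℝ) ≤ P := by exact_mod_cast h30
    have main := perturbed_cubic_log_concave (x := (n + 1 : ℕ)) (B := B) (C := C) (e := e)
      (e₁ := e₁) (e₂ := e₂) (by linarith) (by linarith) (by linarith) (by linarith) (by linarith)
      (by linarith)
    have := mul_lt_mul_of_pos_left main (pow_pos hW 2)
    push_cast at this ⊢
    ring_nf at this ⊢
    exact this
  refine ⟨fun n hn => key n (le_trans (by gcongr; norm_num) hn), fun n hn => ?_⟩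
  have h := key n hn
  have h' : (pA a 4 ((n : ℤ) + 1) : ℝ) * (pA a 4 ((n : ℤ) - 1) : ℝ) <
      (pA a 4 (n : ℤ) : ℝ) ^ 2 := by
    refine lt_of_le_of_lt ?_ h
    rw [mul_assoc]
    exact le_mul_of_one_le_left (by positivity) (le_add_of_nonneg_right (by positivity))
  exact_mod_cast h'
end
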